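/- arXiv:1911.05724 — 4 statements merged into one kernel-verified Lean document; each statement's English description precedes it below -/
import Mathlib

section
/- Let n ≥ 1 be an integer, α a real number, and c ≠ 0, q real. The function y(x) = c·x^q solves y·y^{(n+1)} + α·y'·y^{(n)} = 0 at every point of (0,∞) if and only if q ∈ {0, 1, …, n−1} or (1+α)·q = n. -/
/-- `y` solves the ODE `y * y⁽ⁿ⁺¹⁾ + α * y' * y⁽ⁿ⁾ = 0` on the set `S`:
it is `(n+1)`-times differentiable at each point of `S` and the equation holds there. -/
def Solves (n : ℕ) (α : ℝ) (y : ℝ → ℝ) (S : Set ℝ) : Prop :=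
  (∀ k ≤ n, ∀ x ∈ S, DifferentiableAt ℝ (iteratedDeriv k y) x) ∧
  ∀ x ∈ S, y x * iteratedDeriv (n + 1) y x
      + α * iteratedDeriv 1 y x * iteratedDeriv n y x = 0

theorem iter_formula (c q : ℝ) (k : ℕ) : ∀ x : ℝ, 0 < x →
    iteratedDeriv k (fun x : ℝ => c * x ^ q) x
      = (c * ∏ i ∈ Finset.range k, (q - (i : ℝ))) * x ^ (q - (k : ℝ)) := by
  induction k with
  | zero => intro x hx; simp
  | succ k ih =>
    intro x hx
    rw [iteratedDeriv_succ]
    have he : iteratedDeriv k (fun x : ℝ => c * x ^ q) =ᶠ[nhds x]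
        fun x => (c * ∏ i ∈ Finset.range k, (q - (i : ℝ))) * x ^ (q - (k : ℝ)) := by
      filter_upwards [Ioi_mem_nhds hx] with z hz using ih z hz
    rw [he.deriv_eq, ((Real.hasDerivAt_rpow_const (Or.inl hx.ne')).const_mul _).deriv,
      Finset.prod_range_succ]
    push_cast
    rw [show q - ((k : ℝ) + 1) = q - (k : ℝ) - 1 by ring]
    ring

theorem iter_diff (c q : ℝ) (k : ℕ) (x : ℝ) (hx : 0 < x) :
    DifferentiableAt ℝ (iteratedDeriv k (fun x : ℝ => c * x ^ q)) x := by
  have he : iteratedDeriv k (fun x : ℝ => c * x ^ q) =ᶠ[nhds x]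
      fun x => (c * ∏ i ∈ Finset.range k, (q - (i : ℝ))) * x ^ (q - (k : ℝ)) := by
    filter_upwards [Ioi_mem_nhds hx] with z hz using iter_formula c q k z hz
  exact he.differentiableAt_iff.2
    ((Real.hasDerivAt_rpow_const (Or.inl hx.ne')).const_mul _).differentiableAt

theorem ode_formula (n : ℕ) (α c q x : ℝ) (hx : 0 < x) :
    (fun x : ℝ => c * x ^ q) x * iteratedDeriv (n + 1) (fun x : ℝ => c * x ^ q) x
      + α * iteratedDeriv 1 (fun x : ℝ => c * x ^ q) x
        * iteratedDeriv n (fun x : ℝ => c * x ^ q) x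
    = c ^ 2 * (x ^ q * x ^ (q - (n : ℝ) - 1)) *
      ((∏ i ∈ Finset.range n, (q - (i : ℝ))) * ((1 + α) * q - n)) := by
  have h : x ^ (q - 1) * x ^ (q - (n : ℝ)) = x ^ q * x ^ (q - (n : ℝ) - 1) := by
    rw [← Real.rpow_add hx, ← Real.rpow_add hx]; congr 1; ring
  rw [iter_formula c q (n + 1) x hx, iter_formula c q 1 x hx, iter_formula c q n x hx,
    Finset.prod_range_succ]
  simp only [Finset.prod_range_one]
  push_cast
  rw [show q - ((n : ℝ) + 1) = q - (n : ℝ) - 1 by ring]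
  linear_combination (α * c ^ 2 * q * ∏ i ∈ Finset.range n, (q - (i : ℝ))) * h

/-- For `n ≥ 1`, `c ≠ 0`, the function `y x = c * x ^ q` (real power)
solves `y * y⁽ⁿ⁺¹⁾ + α * y' * y⁽ⁿ⁾ = 0` at every point of `(0,∞)`
iff `q ∈ {0, 1, …, n-1}` or `(1+α) * q = n`. -/
theorem stmt1 (n : ℕ) (hn : 1 ≤ n) (α c q : ℝ) (hc : c ≠ 0) :
    Solves n α (fun x : ℝ => c * x ^ q) (Set.Ioi 0) ↔
      (∃ k : ℕ, k < n ∧ q = (k : ℝ)) ∨ (1 + α) * q = (n : ℝ) := by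
  have key : ((∏ i ∈ Finset.range n, (q - (i : ℝ))) * ((1 + α) * q - n) = 0) ↔
      ((∃ k : ℕ, k < n ∧ q = (k : ℝ)) ∨ (1 + α) * q = (n : ℝ)) := by
    rw [mul_eq_zero, Finset.prod_eq_zero_iff]
    simp only [Finset.mem_range, sub_eq_zero]
  rw [← key]
  constructor
  · intro h
    have h1 := h.2 1 (Set.mem_Ioi.2 one_pos)
    have h2 := (ode_formula n α c q 1 one_pos).symm.trans h1
    simpa only [Real.one_rpow, mul_one, mul_eq_zero, pow_eq_zero_iff two_ne_zero, hc,
      false_or] using h2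
  · intro h
    refine ⟨fun k _ x hx => iter_diff c q k x hx, fun x hx => ?_⟩
    exact (ode_formula n α c q x hx).trans (by rw [h, mul_zero])
end

section
/- Let n ≥ 1 be an integer, α ≠ −1 a real number, and β ≠ 0 real. The function y(x) = 1/(β·x^p) solves y·y^{(n+1)} + α·y'·y^{(n)} = 0 at every point of (0,∞) if and only if p ∈ {0, −1, −2, …, −(n−1)} or p = −n/(1+α). -/
theorem aux_iter (β p : ℝ) (k : ℕ) : ∀ x : ℝ, 0 < x →
    iteratedDeriv k (fun x : ℝ => 1 / (β * x ^ p)) x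
      = β⁻¹ * (∏ i ∈ Finset.range k, (-p - (i : ℝ))) * x ^ (-p - (k : ℝ)) := by
  induction k with
  | zero =>
    intro x hx
    simp [Real.rpow_neg hx.le, mul_comm]
  | succ k ih =>
    intro x hx
    rw [iteratedDeriv_succ]
    have h : iteratedDeriv k (fun x : ℝ => 1 / (β * x ^ p)) =ᶠ[nhds x]
        fun x => β⁻¹ * (∏ i ∈ Finset.range k, (-p - (i : ℝ))) * x ^ (-p - (k : ℝ)) := by
      filter_upwards [Ioi_mem_nhds hx] with z hz using ih z hz
    rw [h.deriv_eq]
    have h2 := (Real.hasDerivAt_rpow_const (x := x) (p := -p - (k : ℝ))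
      (Or.inl hx.ne')).const_mul (β⁻¹ * (∏ i ∈ Finset.range k, (-p - (i : ℝ))))
    rw [h2.deriv, Finset.prod_range_succ]
    have h3 : -p - ((k + 1 : ℕ) : ℝ) = -p - (k : ℝ) - 1 := by push_cast; ring
    rw [h3]
    ring

theorem aux_diff (β p : ℝ) (k : ℕ) (x : ℝ) (hx : 0 < x) :
    DifferentiableAt ℝ (iteratedDeriv k (fun x : ℝ => 1 / (β * x ^ p))) x := by
  have h : iteratedDeriv k (fun x : ℝ => 1 / (β * x ^ p)) =ᶠ[nhds x]
      fun x => β⁻¹ * (∏ i ∈ Finset.range k, (-p - (i : ℝ))) * x ^ (-p - (k : ℝ)) := by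
    filter_upwards [Ioi_mem_nhds hx] with z hz using aux_iter β p k z hz
  rw [h.differentiableAt_iff]
  exact ((Real.hasDerivAt_rpow_const (x := x) (p := -p - (k : ℝ))
      (Or.inl hx.ne')).const_mul _).differentiableAt

theorem aux_eq (n : ℕ) (α β p x : ℝ) (hx : 0 < x) :
    (1 / (β * x ^ p)) * iteratedDeriv (n + 1) (fun x : ℝ => 1 / (β * x ^ p)) x
      + α * iteratedDeriv 1 (fun x : ℝ => 1 / (β * x ^ p)) x
        * iteratedDeriv n (fun x : ℝ => 1 / (β * x ^ p)) x
    = β⁻¹ ^ 2 * x ^ (-p + (-p - (n : ℝ) - 1)) *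
      ((∏ i ∈ Finset.range n, (-p - (i : ℝ))) * (-(p * (1 + α) + n))) := by
  have h0 := aux_iter β p 0 x hx
  rw [iteratedDeriv_zero] at h0
  rw [h0, aux_iter β p _ x hx, aux_iter β p _ x hx, aux_iter β p _ x hx,
    Finset.prod_range_succ]
  have e1 : x ^ (-p + (-p - (n : ℝ) - 1)) = x ^ (-p - ((0 : ℕ) : ℝ)) * x ^ (-p - ((n + 1 : ℕ) : ℝ)) := by
    rw [← Real.rpow_add hx]; congr 1; push_cast; ring
  have e2 : x ^ (-p - ((1 : ℕ) : ℝ)) * x ^ (-p - (n : ℝ))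
      = x ^ (-p - ((0 : ℕ) : ℝ)) * x ^ (-p - ((n + 1 : ℕ) : ℝ)) := by
    rw [← Real.rpow_add hx, ← Real.rpow_add hx]; congr 1; push_cast; ring
  rw [e1]
  simp only [Finset.prod_range_zero, Finset.prod_range_one]
  push_cast at e2 ⊢
  linear_combination (α * β⁻¹ ^ 2 * (-p) * (∏ i ∈ Finset.range n, (-p - (i : ℝ)))) * e2

/-- For `n ≥ 1`, `α ≠ -1`, `β ≠ 0`, the function `y x = 1 / (β * x ^ p)`
(real power) solves `y * y⁽ⁿ⁺¹⁾ + α * y' * y⁽ⁿ⁾ = 0` at every point of `(0,∞)`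
iff `p ∈ {0, -1, -2, …, -(n-1)}` or `p = -n / (1+α)`. -/
theorem stmt2 (n : ℕ) (hn : 1 ≤ n) (α : ℝ) (hα : α ≠ -1) (β p : ℝ) (hβ : β ≠ 0) :
    Solves n α (fun x : ℝ => 1 / (β * x ^ p)) (Set.Ioi 0) ↔
      (∃ k : ℕ, k < n ∧ p = -(k : ℝ)) ∨ p = -(n : ℝ) / (1 + α) := by
  have hα' : 1 + α ≠ 0 := fun h => hα (by linarith)
  have key : Solves n α (fun x : ℝ => 1 / (β * x ^ p)) (Set.Ioi 0) ↔
      (∏ i ∈ Finset.range n, (-p - (i : ℝ))) * (-(p * (1 + α) + n)) = 0 := by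
    constructor
    · rintro ⟨-, h⟩
      have h1 := h 1 (Set.mem_Ioi.2 one_pos)
      rw [aux_eq n α β p 1 one_pos] at h1
      rw [Real.one_rpow] at h1
      exact (mul_eq_zero.1 h1).resolve_left (by simp [hβ])
    · intro h
      refine ⟨fun k _ x hx => aux_diff β p k x hx, fun x hx => ?_⟩
      rw [aux_eq n α β p x hx, h, mul_zero]
  rw [key, mul_eq_zero, Finset.prod_eq_zero_iff]
  refine or_congr ?_ ?_
  · refine exists_congr fun k => ?_
    rw [Finset.mem_range]
    refine and_congr_right fun _ => ?_
    constructor <;> intro h <;> linarith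
  · rw [eq_div_iff hα']
    constructor <;> intro h <;> linarith
end

section
/- Let n ≥ 2 be an integer, α, s real numbers, β ≠ 0 real, and fix x > 0. For m in a neighbourhood of 0 define y_m(t) = 1/(β·t^{−1} + m·t^{s−1}) for t > 0 (defined for m small enough that the denominator is nonzero near x). Then the function m ↦ y_m(x)·y_m^{(n+1)}(x) + α·y_m'(x)·y_m^{(n)}(x), where derivatives are taken with respect to t, is differentiable at m = 0 and its derivative at m = 0 equals −β^{−3}·(s+1)·(∏_{j=0}^{n−2}(s−j))·(s−(n−1)+α)·x^{s−n+1}. -/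
/-- The family of functions `y_m : t ↦ 1 / (β * t⁻¹ + m * t^(s-1))` (real powers). -/
noncomputable def ym (β s m : ℝ) : ℝ → ℝ := fun t : ℝ => 1 / (β * t ^ (-1 : ℝ) + m * t ^ (s - 1))

open scoped ContDiff Topology

lemma aux_smooth (F : ℝ × ℝ → ℝ) (U : Set (ℝ × ℝ)) (hU : IsOpen U) (hF : ContDiffOn ℝ ∞ F U)
    (k : ℕ) :
    ContDiffOn ℝ ∞ (fun p : ℝ × ℝ => iteratedDeriv k (fun t => F (p.1, t)) p.2) U := by
  induction k with
  | zero => simpa using hF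
  | succ k ih =>
    have h1 := ih.fderiv_of_isOpen hU (m := ∞) (by simp)
    have h2 := h1.clm_apply (contDiffOn_const (c := ((0 : ℝ), (1 : ℝ))))
    refine h2.congr ?_
    rintro ⟨m, t⟩ hp
    have hd := ((ih.differentiableOn (by simp)).differentiableAt (hU.mem_nhds hp)).hasFDerivAt
    have hl : HasDerivAt (fun t : ℝ => (m, t)) ((0 : ℝ), (1 : ℝ)) t :=
      (hasDerivAt_const t m).prodMk (hasDerivAt_id t)
    have := (hd.comp_hasDerivAt t hl).deriv
    rw [← this]
    simp only [iteratedDeriv_succ]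
    rfl

lemma aux_rpow (r : ℝ) (k : ℕ) (t : ℝ) (ht : 0 < t) :
    iteratedDeriv k (fun t : ℝ => t ^ r) t
      = (∏ j ∈ Finset.range k, (r - (j : ℝ))) * t ^ (r - (k : ℝ)) := by
  induction k generalizing t with
  | zero => simp
  | succ k ih =>
    rw [iteratedDeriv_succ]
    have he : iteratedDeriv k (fun t : ℝ => t ^ r) =ᶠ[𝓝 t]
        fun t => (∏ j ∈ Finset.range k, (r - (j : ℝ))) * t ^ (r - (k : ℝ)) := by
      filter_upwards [lt_mem_nhds ht] with u hu using ih u hu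
    rw [he.deriv_eq, (((Real.hasDerivAt_rpow_const (Or.inl ht.ne')).const_mul _).deriv),
      Finset.prod_range_succ]
    push_cast
    rw [← sub_sub]
    ring

lemma aux_lin (β : ℝ) (k : ℕ) (hk : 2 ≤ k) (t : ℝ) :
    iteratedDeriv k (fun t : ℝ => β⁻¹ * t) t = 0 := by
  obtain ⟨k, rfl⟩ := Nat.exists_eq_add_of_le' hk
  have h : deriv (fun t : ℝ => β⁻¹ * t) = fun _ => β⁻¹ := by
    funext t; simpa using ((hasDerivAt_id t).const_mul β⁻¹).deriv
  rw [show k + 2 = (k + 1) + 1 from rfl, iteratedDeriv_succ', h, iteratedDeriv_const]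
  simp

lemma aux_main (β s : ℝ) (hβ : β ≠ 0) (x : ℝ) (hx : 0 < x) (k : ℕ) :
    HasDerivAt (fun m : ℝ => iteratedDeriv k (ym β s m) x)
      (-(β ^ 2)⁻¹ * ((∏ j ∈ Finset.range k, (s + 1 - (j : ℝ))) * x ^ (s + 1 - (k : ℝ)))) 0 := by
  let V : Set (ℝ × ℝ) := {p | 0 < p.2}
  have hV : IsOpen V := isOpen_lt continuous_const continuous_snd
  have hpow : ∀ r : ℝ, ContDiffOn ℝ ∞ (fun p : ℝ × ℝ => p.2 ^ r) V := fun r =>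
    contDiffOn_snd.rpow_const_of_ne (fun p hp => (ne_of_gt hp))
  have hD : ContDiffOn ℝ ∞ (fun p : ℝ × ℝ => β * (β + p.1 * p.2 ^ s)) V :=
    contDiffOn_const.mul (contDiffOn_const.add (contDiffOn_fst.mul (hpow s)))
  let U : Set (ℝ × ℝ) := V ∩ (fun p : ℝ × ℝ => β * (β + p.1 * p.2 ^ s)) ⁻¹' {0}ᶜ
  have hU : IsOpen U := hD.continuousOn.isOpen_inter_preimage hV isOpen_compl_singleton
  let F : ℝ × ℝ → ℝ := fun p => p.2 ^ (s + 1) / (β * (β + p.1 * p.2 ^ s))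
  have hF : ContDiffOn ℝ ∞ F U :=
    ((hpow (s+1)).mono Set.inter_subset_left).div (hD.mono Set.inter_subset_left)
      (fun p hp => hp.2)
  have hG := aux_smooth F U hU hF k
  have h0 : ((0 : ℝ), x) ∈ U := ⟨hx, by simp [hβ]⟩
  have hc : DifferentiableAt ℝ (fun m : ℝ => iteratedDeriv k (fun t => F (m, t)) x) 0 := by
    have h1 := (hG.differentiableOn (by simp)).differentiableAt (hU.mem_nhds h0)
    exact DifferentiableAt.comp (0 : ℝ) (f := fun m : ℝ => (m, x)) h1 (by fun_prop)
  have hev : (fun m : ℝ => iteratedDeriv k (ym β s m) x) =ᶠ[𝓝 0]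
      fun m => iteratedDeriv k (fun t : ℝ => β⁻¹ * t) x
        - m * iteratedDeriv k (fun t => F (m, t)) x := by
    have hcont : Filter.Tendsto (fun m : ℝ => (m, x)) (𝓝 0) (𝓝 ((0 : ℝ), x)) :=
      (by fun_prop : Continuous (fun m : ℝ => (m, x))).tendsto 0
    filter_upwards [hcont (hU.mem_nhds h0)] with m hm
    have hm : (m, x) ∈ U := hm
    have hFm : ContDiffAt ℝ k (fun t => F (m, t)) x := by
      have := (hF.contDiffAt (hU.mem_nhds hm)).of_le (m := k) (by exact_mod_cast le_top)
      exact ContDiffAt.comp x (f := fun t : ℝ => (m, t)) this (by fun_prop)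
    have hy : ym β s m =ᶠ[𝓝 x] fun t => β⁻¹ * t - m * F (m, t) := by
      have hcx : Filter.Tendsto (fun t : ℝ => (m, t)) (𝓝 x) (𝓝 (m, x)) :=
        (by fun_prop : Continuous (fun t : ℝ => (m, t))).tendsto x
      filter_upwards [hcx (hU.mem_nhds hm)] with t ht
      have ht0 : 0 < t := ht.1
      have ht1 : β * (β + m * t ^ s) ≠ 0 := ht.2
      have ht2 := right_ne_zero_of_mul ht1
      simp only [ym, F]
      rw [Real.rpow_neg_one, Real.rpow_sub_one ht0.ne', Real.rpow_add_one ht0.ne']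
      have : β * t⁻¹ + m * (t ^ s / t) = (β + m * t ^ s) / t := by field_simp
      rw [this]
      field_simp
      ring
    rw [hy.iteratedDeriv_eq k, iteratedDeriv_fun_sub (by fun_prop) (contDiffAt_const.mul hFm),
      iteratedDeriv_const_mul_field m]
  refine HasDerivAt.congr_of_eventuallyEq ?_ hev
  have h := ((hasDerivAt_id (0 : ℝ)).mul hc.hasDerivAt).const_sub
    (iteratedDeriv k (fun t : ℝ => β⁻¹ * t) x)
  refine h.congr_deriv ?_
  have : (fun t => F (0, t)) = fun t => (β ^ 2)⁻¹ * t ^ (s + 1) := by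
    funext t; simp only [F, zero_mul, add_zero]; field_simp
  simp only [this, iteratedDeriv_const_mul_field, aux_rpow _ _ _ hx, id]
  ring

lemma aux_zero (β s : ℝ) : ym β s 0 = fun t : ℝ => β⁻¹ * t := by
  funext t
  simp [ym, Real.rpow_neg_one, mul_comm]

theorem stmt4 (n : ℕ) (hn : 2 ≤ n) (α s β : ℝ) (hβ : β ≠ 0) (x : ℝ) (hx : 0 < x) :
    HasDerivAt
      (fun m : ℝ =>
        ym β s m x * iteratedDeriv (n + 1) (ym β s m) x
          + α * iteratedDeriv 1 (ym β s m) x * iteratedDeriv n (ym β s m) x)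
      (-(β ^ (-3 : ℤ)) * (s + 1) * (∏ j ∈ Finset.range (n - 1), (s - (j : ℝ)))
          * (s - ((n : ℝ) - 1) + α) * x ^ (s - (n : ℝ) + 1))
      0 := by
  have a0 := aux_main β s hβ x hx 0
  have a1 := aux_main β s hβ x hx 1
  have an := aux_main β s hβ x hx n
  have an1 := aux_main β s hβ x hx (n + 1)
  simp only [iteratedDeriv_zero] at a0
  have h := (a0.mul an1).add ((a1.const_mul α).mul an)
  refine h.congr_deriv ?_
  have hd : iteratedDeriv 1 (fun t : ℝ => β⁻¹ * t) x = β⁻¹ := by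
    rw [iteratedDeriv_one]; simpa using ((hasDerivAt_id x).const_mul β⁻¹).deriv
  simp only [aux_zero, aux_lin β n hn, aux_lin β (n + 1) (by omega), hd]
  obtain ⟨k, rfl⟩ := Nat.exists_eq_add_of_le' hn
  have e1 : x ^ (s + 1 - ((k + 2 : ℕ) : ℝ)) = x ^ (s + 1 - ((k + 2 + 1 : ℕ) : ℝ)) * x := by
    rw [← Real.rpow_add_one hx.ne']; congr 1; push_cast; ring
  have e2 : x ^ (s - ((k + 2 : ℕ) : ℝ) + 1) = x ^ (s + 1 - ((k + 2 + 1 : ℕ) : ℝ)) * x := by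
    rw [← Real.rpow_add_one hx.ne']; congr 1; push_cast; ring
  have e3 : ∏ j ∈ Finset.range (k + 2), (s + 1 - (j : ℝ))
      = (s + 1) * ∏ j ∈ Finset.range (k + 2 - 1), (s - (j : ℝ)) := by
    rw [Finset.prod_range_succ', mul_comm]
    congr 1
    · simp
    · refine Finset.prod_congr rfl fun j _ => ?_
      push_cast; ring
  rw [Finset.prod_range_succ _ (k + 2), e1, e2, e3,
    show β ^ (-3 : ℤ) = (β⁻¹) ^ 3 by rw [zpow_neg, inv_pow]; norm_cast, ← inv_pow]
  push_cast
  ring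
end

section
/- Let y be a positive solution of y·y'' = (y')² on an interval I, and let λ be a real number. Then ỹ(x) = y(x)^λ (real power) solves y·y'' = (y')² at every point of I. -/
/-- `y` solves the ODE `y * y'' = (y')²` on the set `S`:
it is twice differentiable at each point of `S` and the equation holds there. -/
def SolvesLog (y : ℝ → ℝ) (S : Set ℝ) : Prop :=
  (∀ x ∈ S, DifferentiableAt ℝ y x ∧ DifferentiableAt ℝ (deriv y) x) ∧
  ∀ x ∈ S, y x * iteratedDeriv 2 y x = (deriv y x) ^ 2

/-- The chain rule for `y ^ lam` near positive values, valid also at points where `y` is not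
differentiable (both sides are then zero). -/
theorem deriv_rpow_of_eventually_pos (y : ℝ → ℝ) (lam z : ℝ)
    (hz : ∀ᶠ w in nhds z, 0 < y w) :
    deriv (fun x : ℝ => y x ^ lam) z = lam * y z ^ (lam - 1) * deriv y z := by
  have hz0 : 0 < y z := hz.self_of_nhds
  by_cases hd : DifferentiableAt ℝ y z
  · rw [(hd.hasDerivAt.rpow_const (p := lam) (Or.inl hz0.ne')).deriv]
    ring
  · rw [deriv_zero_of_not_differentiableAt hd, mul_zero]
    by_cases hl : lam = 0
    · simp [hl]
    · apply deriv_zero_of_not_differentiableAt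
      intro h
      apply hd
      have h2 : DifferentiableAt ℝ (fun x : ℝ => (y x ^ lam) ^ lam⁻¹) z :=
        h.rpow_const (Or.inl (Real.rpow_pos_of_pos hz0 lam).ne')
      refine h2.congr_of_eventuallyEq ?_
      filter_upwards [hz] with w hw
      exact (Real.rpow_rpow_inv hw.le hl).symm

/-- If `y` is a positive solution of `y * y'' = (y')²` on an interval `I`
and `λ` is real, then `ỹ x = y x ^ λ` (real power) solves the same equation on `I`. -/
theorem stmt13 (y : ℝ → ℝ) (I : Set ℝ) (hI : I.OrdConnected)
    (hpos : ∀ x ∈ I, 0 < y x) (hy : SolvesLog y I) (lam : ℝ) :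
    SolvesLog (fun x : ℝ => y x ^ lam) I := by
  obtain ⟨hd, he⟩ := hy
  have key : ∀ x ∈ I, HasDerivAt (deriv (fun x : ℝ => y x ^ lam))
      (lam * (deriv y x * (lam - 1) * y x ^ (lam - 1 - 1)) * deriv y x
        + lam * y x ^ (lam - 1) * deriv (deriv y) x) x := by
    intro x hx
    have hp : ∀ᶠ w in nhds x, 0 < y w :=
      (hd x hx).1.continuousAt.eventually (lt_mem_nhds (hpos x hx))
    have h1 := (((hd x hx).1.hasDerivAt.rpow_const (p := lam - 1)
      (Or.inl (hpos x hx).ne')).const_mul lam).mul (hd x hx).2.hasDerivAt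
    refine h1.congr_of_eventuallyEq ?_
    filter_upwards [hp.eventually_nhds] with z hz
    exact deriv_rpow_of_eventually_pos y lam z hz
  refine ⟨fun x hx => ⟨(hd x hx).1.rpow_const (Or.inl (hpos x hx).ne'),
    (key x hx).differentiableAt⟩, fun x hx => ?_⟩
  have h0 := hpos x hx
  have h := he x hx
  have hp : ∀ᶠ w in nhds x, 0 < y w :=
    (hd x hx).1.continuousAt.eventually (lt_mem_nhds h0)
  rw [iteratedDeriv_succ, iteratedDeriv_one] at h ⊢
  rw [(key x hx).deriv, deriv_rpow_of_eventually_pos y lam x hp]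
  have e1 : y x ^ (lam - 1) = y x ^ (lam - 1 - 1) * y x := by
    rw [← Real.rpow_add_one h0.ne']; congr 1; ring
  have e2 : y x ^ lam = y x ^ (lam - 1 - 1) * y x * y x := by
    rw [← e1, ← Real.rpow_add_one h0.ne']; congr 1; ring
  simp only [e1, e2]
  generalize y x ^ (lam - 1 - 1) = c
  linear_combination (lam * c ^ 2 * y x ^ 2) * h
end
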